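/- Let 1<p<∞, 1≤q≤∞, and β>0, and let E⊂X be a compact set. Then Cp^β_{p,q}(E)^{1/p} = sup{ ν(E) / ‖Ȟ_β ν‖_{L^{p'}(X;l^{q'})} : ν∈𝓜⁺(E) }, where p'=p/(p-1) and q' is the conjugate exponent of q (q'=∞ if q=1, q'=1 if q=∞). -/

import Mathlib

open MeasureTheory Metric Set
open scoped ENNReal NNReal

noncomputable section

namespace TLCap

variable {X : Type*} [MetricSpace X] [MeasurableSpace X] [BorelSpace X]

/-- `validIdx X n` means `n ≥ n₀`, i.e. `2^{-n} ≤ 2 diam X`;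
all `n : ℤ` are valid when `X` is unbounded. -/
def validIdx (X : Type*) [PseudoMetricSpace X] (n : ℤ) : Prop :=
  ENNReal.ofReal ((2 : ℝ) ^ (-n)) ≤ 2 * EMetric.diam (Set.univ : Set X)

/-- The doubling condition for `μ`, with doubling constant `c`. -/
def IsDoubling (μ : Measure X) (c : ℝ≥0∞) : Prop :=
  ∀ (x : X) (r : ℝ), 0 < r → μ (ball x (2 * r)) ≤ c * μ (ball x r)

/-- The reverse doubling condition with constant `c`. -/
def IsReverseDoubling (μ : Measure X) (c : ℝ≥0∞) : Prop :=
  ∀ (x : X) (r : ℝ), 0 < r → 2 * ENNReal.ofReal r < EMetric.diam (Set.univ : Set X) →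
    μ (ball x (r / 2)) ≤ c * μ (ball x r)

/-- The quantitative reverse doubling condition with exponent `σ` and constant `c`. -/
def IsQRD (μ : Measure X) (σ : ℝ) (c : ℝ≥0∞) : Prop :=
  ∀ (x : X) (r R : ℝ), 0 < r → r < R →
    ENNReal.ofReal R ≤ 2 * EMetric.diam (Set.univ : Set X) →
    μ (ball x r) ≤ c * ENNReal.ofReal ((r / R) ^ σ) * μ (ball x R)

open Classical in
/-- The `l^q` norm of a sequence of extended nonnegative reals (`q = ∞` allowed). -/
def lqNorm (q : ℝ≥0∞) (a : ℤ → ℝ≥0∞) : ℝ≥0∞ :=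
  if q = ∞ then ⨆ k, a k else (∑' k, a k ^ q.toReal) ^ (1 / q.toReal)

/-- The mixed norm `‖g‖_{L^p(Ω; l^q)}`. -/
def mixedNorm (μ : Measure X) (Ω : Set X) (p : ℝ) (q : ℝ≥0∞) (g : ℤ → X → ℝ≥0∞) : ℝ≥0∞ :=
  (∫⁻ x in Ω, lqNorm q (fun k => g k x) ^ p ∂μ) ^ (1 / p)

/-- `g = (g_k)_{k ∈ ℤ}` is a fractional `β`-Hajłasz gradient of `u` on `Ω`. -/
def IsFracGrad (μ : Measure X) (β : ℝ) (Ω : Set X) (u : X → ℝ) (g : ℤ → X → ℝ≥0∞) : Prop :=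
  (∀ k, Measurable (g k)) ∧
  ∃ N : Set X, N ⊆ Ω ∧ μ N = 0 ∧
    ∀ (k : ℤ), ∀ x ∈ Ω \ N, ∀ y ∈ Ω \ N,
      (2 : ℝ) ^ (-k - 1) ≤ dist x y → dist x y < (2 : ℝ) ^ (-k) →
      ENNReal.ofReal |u x - u y| ≤ ENNReal.ofReal (dist x y ^ β) * (g k x + g k y)

/-- The homogeneous Hajłasz–Triebel–Lizorkin seminorm `|u|_{Ṁ^β_{p,q}(Ω)}`. -/
def htlSeminorm (μ : Measure X) (β p : ℝ) (q : ℝ≥0∞) (Ω : Set X) (u : X → ℝ) : ℝ≥0∞ :=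
  ⨅ g : {g : ℤ → X → ℝ≥0∞ // IsFracGrad μ β Ω u g}, mixedNorm μ Ω p q g.1

/-- The relative Hajłasz–Triebel–Lizorkin capacity `cap^β_{p,q}(E, 2B, ΛB)`,
where `B = B(x₀, r)`. -/
def relCap (μ : Measure X) (β p : ℝ) (q : ℝ≥0∞) (E : Set X) (x₀ : X) (r Λ : ℝ) : ℝ≥0∞ :=
  ⨅ φ : {φ : X → ℝ // Continuous φ ∧ (∀ x ∈ E, 1 ≤ φ x) ∧ ∀ x ∉ ball x₀ (2 * r), φ x = 0},
    htlSeminorm μ β p q (ball x₀ (Λ * r)) φ.1 ^ p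

open Classical in
/-- The potential `H_β f`. -/
def Hpot (μ : Measure X) (β : ℝ) (f : ℤ → X → ℝ≥0∞) (x : X) : ℝ≥0∞ :=
  ∑' n : ℤ, if validIdx X n then
    (2 : ℝ≥0∞) ^ (-β * (n : ℝ)) *
      ∫⁻ y, (ball y ((2 : ℝ) ^ (-n))).indicator (fun _ => (1 : ℝ≥0∞)) x * f n y /
        μ (ball y ((2 : ℝ) ^ (-n))) ∂μ
  else 0

/-- A sequence `(f_n)_{n ≥ n₀}` of nonnegative Borel functions, realized as a sequence
indexed by `ℤ` vanishing at invalid indices. -/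
def IsAdmissibleSeq (f : ℤ → X → ℝ≥0∞) : Prop :=
  (∀ n, Measurable (f n)) ∧ ∀ n, ¬ validIdx X n → f n = 0

/-- The Triebel–Lizorkin `(β,p,q)`-capacity `Cp^β_{p,q}(E)`. -/
def CpCap (μ : Measure X) (β p : ℝ) (q : ℝ≥0∞) (E : Set X) : ℝ≥0∞ :=
  ⨅ f : {f : ℤ → X → ℝ≥0∞ // IsAdmissibleSeq f ∧ ∀ x ∈ E, 1 ≤ Hpot μ β f x},
    mixedNorm μ Set.univ p q f.1 ^ p

open Classical in
/-- The sequence `Ȟ_β ν`. -/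
def Hcheck (μ ν : Measure X) (β : ℝ) : ℤ → X → ℝ≥0∞ := fun n x =>
  if validIdx X n then
    (2 : ℝ≥0∞) ^ (-β * (n : ℝ)) * ν (ball x ((2 : ℝ) ^ (-n))) / μ (ball x ((2 : ℝ) ^ (-n)))
  else 0

/-- `ν` is a nonnegative Radon measure on the (compact) set `E`. -/
def IsRadonOn (ν : Measure X) (E : Set X) : Prop :=
  ν Eᶜ = 0 ∧ ν E ≠ ∞ ∧
  (∀ F : Set X, MeasurableSet F → F ⊆ E →
    ν F = ⨅ (U : Set X) (_ : IsOpen U) (_ : F ⊆ U ∩ E), ν (U ∩ E)) ∧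
  (∀ F : Set X, MeasurableSet F → F ⊆ E →
    ν F = ⨆ (K : Set X) (_ : IsCompact K) (_ : K ⊆ F), ν K)

open Classical in
/-- The conjugate exponent, with `1' = ∞` and `∞' = 1`. -/
def conjExp (q : ℝ≥0∞) : ℝ≥0∞ :=
  if q = 1 then ∞ else if q = ∞ then 1 else ENNReal.ofReal (q.toReal / (q.toReal - 1))

/-- `2^{-n₀}` (equal to `∞` when `X` is unbounded). -/
def radMax (X : Type*) [PseudoMetricSpace X] : ℝ≥0∞ :=
  ⨆ (n : ℤ) (_ : validIdx X n), ENNReal.ofReal ((2 : ℝ) ^ (-n))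

/-- The fractional maximal function `M_β ν`. -/
def fracMax (μ ν : Measure X) (β : ℝ) (x : X) : ℝ≥0∞ :=
  ⨆ (r : ℝ) (_ : 0 < r) (_ : ENNReal.ofReal r ≤ radMax X),
    ENNReal.ofReal (r ^ β) * ν (ball x r) / μ (ball x r)

/-- The Riesz potential `I_β ν` of a nonnegative Borel measure. -/
def rieszPot (μ ν : Measure X) (β : ℝ) (x : X) : ℝ≥0∞ :=
  ∫⁻ y in {x}ᶜ, ENNReal.ofReal (dist x y ^ β) / μ (ball x (dist x y)) ∂ν

/-- The Riesz `(β,p)`-capacity `R_{β,p}(E)`. -/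
def rieszCap (μ : Measure X) (β p : ℝ) (E : Set X) : ℝ≥0∞ :=
  ⨅ f : {f : X → ℝ≥0∞ // Measurable f ∧ ∀ x ∈ E, 1 ≤ rieszPot μ (μ.withDensity f) β x},
    ∫⁻ x, f.1 x ^ p ∂μ

/-- The `ρ`-restricted Hausdorff content of codimension `d`. -/
def hContent (μ : Measure X) (d : ℝ) (ρ : ℝ≥0∞) (F : Set X) : ℝ≥0∞ :=
  ⨅ c : {c : ℕ → X × ℝ //
      (∀ k, 0 < (c k).2 ∧ ENNReal.ofReal (c k).2 ≤ ρ) ∧ F ⊆ ⋃ k, ball (c k).1 (c k).2},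
    ∑' k, μ (ball (c.1 k).1 (c.1 k).2) * ENNReal.ofReal ((c.1 k).2 ^ (-d))

/-- Partition of unity data at every valid scale: the balls `B(x_{n,i}, 2^{-n-1})` are pairwise
disjoint, the balls `B(x_{n,i}, 2^{-n})` cover `X`, and `ψ_{n,i}` is the associated
partition of unity with constants `κ` and `L`. -/
def IsPartition {ι : ℤ → Type*} (pt : ∀ n, ι n → X)
    (ψ : ∀ n, ι n → X → ℝ) (κ L : ℝ) : Prop :=
  ∀ n : ℤ, validIdx X n →
    (∀ i j : ι n, i ≠ j →
        Disjoint (ball (pt n i) ((2:ℝ) ^ (-n - 1))) (ball (pt n j) ((2:ℝ) ^ (-n - 1)))) ∧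
    (∀ x : X, ∃ i : ι n, x ∈ ball (pt n i) ((2:ℝ) ^ (-n))) ∧
    (∀ (i : ι n) (x : X), 0 ≤ ψ n i x ∧ ψ n i x ≤ 1) ∧
    (∀ (i : ι n), ∀ x ∉ ball (pt n i) (6 * (2:ℝ) ^ (-n)), ψ n i x = 0) ∧
    (∀ (i : ι n), ∀ x ∈ ball (pt n i) (3 * (2:ℝ) ^ (-n)), κ ≤ ψ n i x) ∧
    (∀ i : ι n, LipschitzWith (Real.toNNReal ((2:ℝ) ^ n * L)) (ψ n i)) ∧
    (∀ x : X, HasSum (fun i : ι n => ψ n i x) 1)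

open Classical in
/-- The discrete potential `L_β f`. -/
def discPot {ι : ℤ → Type*} (μ : Measure X) (β : ℝ) (pt : ∀ n, ι n → X)
    (ψ : ∀ n, ι n → X → ℝ) (f : ℤ → X → ℝ≥0∞) (x : X) : ℝ≥0∞ :=
  ∑' n : ℤ, if validIdx X n then
    (2 : ℝ≥0∞) ^ (-β * (n : ℝ)) *
      ∑' i : ι n, ENNReal.ofReal (ψ n i x) *
        ((∫⁻ y in ball (pt n i) (3 * (2:ℝ) ^ (-n)), f n y ∂μ) /
          μ (ball (pt n i) (3 * (2:ℝ) ^ (-n))))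
  else 0

/-- A geodesic metric space: any two points are joined by an isometric image of an interval. -/
def IsGeodesicSpace (X : Type*) [MetricSpace X] : Prop :=
  ∀ x y : X, ∃ γ : ℝ → X, γ 0 = x ∧ γ (dist x y) = y ∧
    ∀ s ∈ Set.Icc (0:ℝ) (dist x y), ∀ t ∈ Set.Icc (0:ℝ) (dist x y),
      dist (γ s) (γ t) = |s - t|

/-- The Hajłasz–Triebel–Lizorkin `(β,p,q)`-capacity density condition with
constants `c₀, c₁, Λ`. -/
def HTLDensity (μ : Measure X) (β p : ℝ) (q : ℝ≥0∞) (E : Set X) (c₀ c₁ Λ : ℝ) : Prop :=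
  ∀ x ∈ E, ∀ r : ℝ, 0 < r → ENNReal.ofReal r < ENNReal.ofReal c₁ * EMetric.diam E →
    ENNReal.ofReal c₀ * relCap μ β p q (closure (ball x r)) x r Λ ≤
      relCap μ β p q (E ∩ closure (ball x r)) x r Λ

/-- The Riesz `(β,p)`-capacity density condition with constant `c₀`. -/
def RieszDensity (μ : Measure X) (β p : ℝ) (E : Set X) (c₀ : ℝ) : Prop :=
  ∀ x ∈ E, ∀ r : ℝ, 0 < r → ENNReal.ofReal (8 * r) < EMetric.diam E →
    ENNReal.ofReal c₀ * rieszCap μ β p (closure (ball x r)) ≤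
      rieszCap μ β p (E ∩ closure (ball x r))

/-- The Hausdorff content density condition of codimension `d` with constant `c₀`. -/
def HausdorffDensity (μ : Measure X) (d : ℝ) (E : Set X) (c₀ : ℝ) : Prop :=
  ∀ x ∈ E, ∀ r : ℝ, 0 < r → ENNReal.ofReal r < EMetric.diam E →
    ENNReal.ofReal c₀ * hContent μ d (ENNReal.ofReal r) (closure (ball x r)) ≤
      hContent μ d (ENNReal.ofReal r) (E ∩ closure (ball x r))

lemma lqNorm_top (a : ℤ → ℝ≥0∞) : lqNorm ∞ a = ⨆ k, a k := if_pos rfl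

lemma lqNorm_of_ne_top {q : ℝ≥0∞} (hq : q ≠ ∞) (a : ℤ → ℝ≥0∞) :
    lqNorm q a = (∑' k, a k ^ q.toReal) ^ (1 / q.toReal) := if_neg hq

lemma toReal_one_le {q : ℝ≥0∞} (hq : 1 ≤ q) (hq' : q ≠ ∞) : 1 ≤ q.toReal := by
  simpa using ENNReal.toReal_mono hq' hq

lemma lqNorm_mono (q : ℝ≥0∞) {a b : ℤ → ℝ≥0∞} (h : ∀ k, a k ≤ b k) :
    lqNorm q a ≤ lqNorm q b := by
  unfold lqNorm
  split_ifs with hq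
  · exact iSup_mono h
  · gcongr
    exact h _

lemma lqNorm_add_le {q : ℝ≥0∞} (hq : 1 ≤ q) (a b : ℤ → ℝ≥0∞) :
    lqNorm q (fun k => a k + b k) ≤ lqNorm q a + lqNorm q b := by
  by_cases hq' : q = ∞
  · subst hq'
    simp only [lqNorm_top]
    exact iSup_le fun k => add_le_add (le_iSup a k) (le_iSup b k)
  · simp only [lqNorm_of_ne_top hq', ← lintegral_count]
    exact ENNReal.lintegral_Lp_add_le (f := a) (g := b) measurable_from_top.aemeasurable
      measurable_from_top.aemeasurable (toReal_one_le hq hq')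

lemma lqNorm_const_mul {q : ℝ≥0∞} (hq : 1 ≤ q) (c : ℝ≥0∞) (a : ℤ → ℝ≥0∞) :
    lqNorm q (fun k => c * a k) = c * lqNorm q a := by
  by_cases hq' : q = ∞
  · subst hq'
    simp only [lqNorm_top, ENNReal.mul_iSup]
  · have h0 : 0 < q.toReal := one_pos.trans_le (toReal_one_le hq hq')
    simp only [lqNorm_of_ne_top hq', ENNReal.mul_rpow_of_nonneg _ _ h0.le, ENNReal.tsum_mul_left]
    rw [ENNReal.mul_rpow_of_nonneg _ _ (by positivity), ← ENNReal.rpow_mul,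
      mul_one_div_cancel h0.ne', ENNReal.rpow_one]

lemma measurable_lqNorm {α : Type*} [MeasurableSpace α] (q : ℝ≥0∞) {f : ℤ → α → ℝ≥0∞}
    (hf : ∀ k, Measurable (f k)) : Measurable fun x => lqNorm q fun k => f k x := by
  unfold lqNorm
  split_ifs
  · exact Measurable.iSup hf
  · exact (Measurable.tsum fun k => (hf k).pow_const _).pow_const _

lemma holderConjugate_conjExp {q : ℝ≥0∞} (hq : 1 < q) (hq' : q ≠ ∞) :
    conjExp q ≠ ∞ ∧ q.toReal.HolderConjugate (conjExp q).toReal := by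
  have h1 : 1 < q.toReal := by simpa using ENNReal.toReal_strict_mono hq' hq
  have : conjExp q = ENNReal.ofReal (q.toReal / (q.toReal - 1)) := by
    simp [conjExp, hq.ne', hq']
  rw [this, ENNReal.toReal_ofReal (div_nonneg (by linarith) (by linarith))]
  exact ⟨ENNReal.ofReal_ne_top, Real.HolderConjugate.conjExponent h1⟩

lemma conjExp_one : conjExp 1 = ∞ := by simp [conjExp]

lemma conjExp_top : conjExp ∞ = 1 := by simp [conjExp]

/-- Hölder's inequality for sequences. -/
lemma tsum_mul_le_lqNorm_mul_lqNorm {q : ℝ≥0∞} (hq : 1 ≤ q) (a b : ℤ → ℝ≥0∞) :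
    ∑' k, a k * b k ≤ lqNorm q a * lqNorm (conjExp q) b := by
  rcases hq.eq_or_lt with rfl | hq1
  · rw [conjExp_one, lqNorm_top, lqNorm_of_ne_top ENNReal.one_ne_top]
    simp only [ENNReal.toReal_one, ENNReal.rpow_one, div_one, ← ENNReal.tsum_mul_right]
    gcongr with k
    exact le_iSup b k
  by_cases hq' : q = ∞
  · subst hq'
    rw [conjExp_top, lqNorm_top, lqNorm_of_ne_top ENNReal.one_ne_top]
    simp only [ENNReal.toReal_one, ENNReal.rpow_one, div_one, ← ENNReal.tsum_mul_left]
    gcongr with k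
    exact le_iSup a k
  · obtain ⟨h1, h2⟩ := holderConjugate_conjExp hq1 hq'
    simp only [lqNorm_of_ne_top hq', lqNorm_of_ne_top h1, ← lintegral_count]
    exact ENNReal.lintegral_mul_le_Lp_mul_Lq _ h2 measurable_from_top.aemeasurable
      measurable_from_top.aemeasurable

/-- The `l^q` norm is the limit of the norms of the truncations to `[-N, N]`. -/
lemma lqNorm_eq_iSup_truncate {q : ℝ≥0∞} (hq : 1 ≤ q) (a : ℤ → ℝ≥0∞) :
    lqNorm q a =
      ⨆ N : ℕ, lqNorm q ((Finset.Icc (-(N : ℤ)) N : Set ℤ).indicator a) := by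
  apply le_antisymm
  · by_cases hq' : q = ∞
    · subst hq'
      simp only [lqNorm_top]
      refine iSup_le fun k => ?_
      refine le_iSup_of_le k.natAbs (le_iSup_of_le k ?_)
      rw [indicator_of_mem]
      simp only [Finset.coe_Icc, mem_Icc]
      omega
    · have h0 : 0 < q.toReal := one_pos.trans_le (toReal_one_le hq hq')
      have hs : ∀ t : Finset ℤ, ∃ N : ℕ, t ⊆ Finset.Icc (-(N : ℤ)) N := by
        intro t
        refine ⟨t.sup Int.natAbs, fun k hk => ?_⟩
        have := Finset.le_sup (f := Int.natAbs) hk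
        simp only [Finset.mem_Icc]
        omega
      rw [lqNorm_of_ne_top hq', ENNReal.tsum_eq_iSup_sum' _ hs,
        (ENNReal.monotone_rpow_of_nonneg (one_div_pos.2 h0).le).map_iSup_of_continuousAt
          ENNReal.continuous_rpow_const.continuousAt (by simp [h0])]
      refine iSup_mono fun N => ?_
      rw [lqNorm_of_ne_top hq']
      gcongr
      refine le_trans (Finset.sum_le_sum fun k hk => ?_) (ENNReal.sum_le_tsum
        (Finset.Icc (-(N : ℤ)) N))
      rw [indicator_of_mem (by simpa using hk)]
  · exact iSup_le fun N => lqNorm_mono q fun k => indicator_le_self _ _ _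

/-- The extremal function in Hölder's inequality. -/
lemma extremal_holder {α : Type*} [MeasurableSpace α] (ρ : Measure α) {r r' : ℝ}
    (hr : r.HolderConjugate r') {g : α → ℝ≥0∞} (hg : Measurable g)
    (hI : ∫⁻ x, g x ^ r' ∂ρ ≠ ∞) :
    ∫⁻ x, (g x ^ (r' - 1) * ((∫⁻ x, g x ^ r' ∂ρ) ^ (1 / r))⁻¹) ^ r ∂ρ ≤ 1 ∧
      (∫⁻ x, g x ^ r' ∂ρ) ^ (1 / r') ≤
        ∫⁻ x, (g x ^ (r' - 1) * ((∫⁻ x, g x ^ r' ∂ρ) ^ (1 / r))⁻¹) * g x ∂ρ := by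
  set I := ∫⁻ x, g x ^ r' ∂ρ with hIdef
  have h0 := hr.pos
  have h0' := hr.symm.pos
  have h1 := hr.symm.lt
  constructor
  · have : ∀ x, (g x ^ (r' - 1) * (I ^ (1 / r))⁻¹) ^ r = g x ^ r' * I⁻¹ := fun x => by
      rw [ENNReal.mul_rpow_of_nonneg _ _ h0.le, ← ENNReal.rpow_mul, hr.symm.sub_one_mul_conj,
        ENNReal.inv_rpow, ← ENNReal.rpow_mul, one_div_mul_cancel h0.ne', ENNReal.rpow_one]
    simp only [this]
    rw [lintegral_mul_const _ (hg.pow_const _), ← hIdef]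
    exact ENNReal.mul_inv_le_one _
  · have : ∀ x, g x ^ (r' - 1) * (I ^ (1 / r))⁻¹ * g x = g x ^ r' * (I ^ (1 / r))⁻¹ := fun x => by
      rw [mul_right_comm]
      congr 1
      conv_lhs => rw [← ENNReal.rpow_one (g x), ← ENNReal.rpow_mul, one_mul]
      rw [← ENNReal.rpow_add_of_nonneg _ _ (by linarith) zero_le_one, sub_add_cancel]
    simp only [this]
    rw [lintegral_mul_const _ (hg.pow_const _), ← hIdef]
    rcases eq_or_ne I 0 with h | h
    · rw [h, ENNReal.zero_rpow_of_pos (by positivity)]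
      exact zero_le
    · rw [← ENNReal.rpow_neg]
      conv_rhs => rw [← ENNReal.rpow_one I, ← ENNReal.rpow_mul, one_mul]
      rw [← ENNReal.rpow_add _ _ h hI]
      refine le_of_eq (congrArg _ ?_)
      have := hr.inv_add_inv_eq_one
      simp only [one_div]
      linarith

/-- A measurable selection of the maximum of finitely many functions. -/
lemma exists_measurable_convex_weights_eq_iSup {α : Type*} [MeasurableSpace α]
    {G : ℤ → α → ℝ≥0∞} (hG : ∀ k, Measurable (G k)) (s : Finset ℤ) :
    ∃ a : ℤ → α → ℝ≥0∞, (∀ k, Measurable (a k)) ∧ (∀ x, ∑' k, a k x ≤ 1) ∧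
      ∀ x, (⨆ k, (s : Set ℤ).indicator (fun k => G k x) k) ≤ ∑' k, a k x * G k x := by
  classical
  induction s using Finset.induction_on with
  | empty => exact ⟨0, fun _ => measurable_zero, by simp, by simp⟩
  | insert j s _ ih =>
    obtain ⟨a, ha, ha1, haG⟩ := ih
    have hS : Measurable fun x => ∑' k, a k x * G k x :=
      Measurable.tsum fun k => (ha k).mul (hG k)
    have hT : MeasurableSet {x | ∑' k, a k x * G k x ≤ G j x} := measurableSet_le hS (hG j)
    have key : ∀ x, (∑' k, a k x * G k x ≤ G j x →
        ∑' k, (Pi.single j 1 : ℤ → ℝ≥0∞) k * G k x = G j x) := fun x _ => by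
      rw [tsum_eq_single j (fun k hk => by simp [hk])]
      simp
    refine ⟨fun k => {x | ∑' k, a k x * G k x ≤ G j x}.piecewise
      (fun _ => (Pi.single j 1 : ℤ → ℝ≥0∞) k) (a k),
      fun k => measurable_const.piecewise hT (ha k), fun x => ?_, fun x => ?_⟩
    · by_cases hx : ∑' k, a k x * G k x ≤ G j x
      · simp only [piecewise, mem_ofPred_eq, hx, if_true]
        rw [tsum_eq_single j (fun k hk => by simp [hk])]
        simp
      · simpa only [piecewise, mem_ofPred_eq, hx, if_false] using ha1 x
    · have h1 : max (G j x) (∑' k, a k x * G k x) ≤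
          ∑' k, {x | ∑' k, a k x * G k x ≤ G j x}.piecewise
            (fun _ => (Pi.single j 1 : ℤ → ℝ≥0∞) k) (a k) x * G k x := by
        by_cases hx : ∑' k, a k x * G k x ≤ G j x
        · simp only [piecewise, mem_ofPred_eq, hx, if_true]
          rw [key x hx, max_eq_left hx]
        · simp only [piecewise, mem_ofPred_eq, hx, if_false]
          rw [max_eq_right (not_le.1 hx).le]
      refine le_trans (iSup_le fun k => ?_) h1
      by_cases hk : k ∈ s
      · rw [indicator_of_mem (by simp [hk])]
        refine le_max_of_le_right (le_trans ?_ (haG x))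
        refine le_iSup_of_le k ?_
        rw [indicator_of_mem (by simpa using hk)]
      · by_cases hkj : k = j
        · subst hkj
          rw [indicator_of_mem (by simp)]
          exact le_max_left _ _
        · rw [indicator_of_notMem (by simp [hk, hkj])]
          exact zero_le

/-- Measurable choice of sequences that are extremal in Hölder's inequality for truncations. -/
lemma exists_measurable_extremal {α : Type*} [MeasurableSpace α] {q : ℝ≥0∞} (hq : 1 ≤ q)
    {G : ℤ → α → ℝ≥0∞} (hG : ∀ k, Measurable (G k)) (hfin : ∀ k x, G k x ≠ ∞) (s : Finset ℤ) :
    ∃ a : ℤ → α → ℝ≥0∞, (∀ k, Measurable (a k)) ∧ (∀ x, lqNorm q (fun k => a k x) ≤ 1) ∧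
      ∀ x, lqNorm (conjExp q) ((s : Set ℤ).indicator fun k => G k x) ≤
        ∑' k, a k x * G k x := by
  rcases hq.eq_or_lt with rfl | hq1
  · obtain ⟨a, ha, ha1, haG⟩ := exists_measurable_convex_weights_eq_iSup hG s
    refine ⟨a, ha, fun x => ?_, fun x => ?_⟩
    · simpa [lqNorm_of_ne_top ENNReal.one_ne_top] using ha1 x
    · rw [conjExp_one, lqNorm_top]
      exact haG x
  by_cases hq' : q = ∞
  · subst hq'
    refine ⟨fun _ _ => 1, fun _ => measurable_const, fun x => ?_, fun x => ?_⟩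
    · simp [lqNorm_top]
    · rw [conjExp_top, lqNorm_of_ne_top ENNReal.one_ne_top]
      simp only [ENNReal.toReal_one, ENNReal.rpow_one, div_one, one_mul]
      exact ENNReal.tsum_le_tsum fun k => indicator_le_self _ _ _
  obtain ⟨h1, h2⟩ := holderConjugate_conjExp hq1 hq'
  set r := q.toReal
  set r' := (conjExp q).toReal
  set T : ℤ → α → ℝ≥0∞ := fun k x => (s : Set ℤ).indicator (fun k => G k x) k with hTdef
  have hT : ∀ k, Measurable (T k) := fun k => by
    by_cases hk : k ∈ s
    · simpa [hTdef, hk] using hG k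
    · simp [hTdef, hk]
  have hI : ∀ x, ∑' k, T k x ^ r' ≠ ∞ := fun x => by
    rw [tsum_eq_sum (s := s) (fun k hk => by simp [hTdef, hk, h2.symm.pos])]
    refine ENNReal.sum_ne_top.2 fun k hk => ENNReal.rpow_ne_top_of_nonneg h2.symm.nonneg ?_
    simpa [hTdef, hk] using hfin k x
  have key := fun x => extremal_holder (Measure.count : Measure ℤ) h2 (g := fun k => T k x)
    measurable_from_top (by rw [lintegral_count]; exact hI x)
  simp only [lintegral_count] at key
  refine ⟨fun k x => T k x ^ (r' - 1) * ((∑' k, T k x ^ r') ^ (1 / r))⁻¹, fun k => ?_,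
    fun x => ?_, fun x => ?_⟩
  · exact ((hT k).pow_const _).mul
      ((Measurable.tsum fun k => (hT k).pow_const _).pow_const _).inv
  · rw [lqNorm_of_ne_top hq']
    exact ENNReal.rpow_le_one (key x).1 (by have := h2.pos; positivity)
  · rw [lqNorm_of_ne_top h1]
    refine (key x).2.trans (ENNReal.tsum_le_tsum fun k => ?_)
    gcongr
    exact indicator_le_self _ _ _

/-- The converse of Hölder's inequality in `L^p`. -/
lemma lintegral_rpow_le_of_forall {α : Type*} [MeasurableSpace α] (μ : Measure α) [SigmaFinite μ]
    {p p' : ℝ} (hp : p.HolderConjugate p') {A : α → ℝ≥0∞} (hA : Measurable A) {m : ℝ≥0∞}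
    (h : ∀ φ : α → ℝ≥0∞, Measurable φ → ∫⁻ x, φ x ^ p ∂μ ≤ 1 → ∫⁻ x, φ x * A x ∂μ ≤ m) :
    (∫⁻ x, A x ^ p' ∂μ) ^ (1 / p') ≤ m := by
  have h0' := hp.symm.pos
  set T : ℕ → α → ℝ≥0∞ := fun N => (spanningSets μ N).indicator fun x => min (A x) N with hT
  have hTm : ∀ N, Measurable (T N) := fun N =>
    (hA.min measurable_const).indicator (measurableSet_spanningSets μ N)
  have hTA : ∀ N x, T N x ≤ A x := fun N x =>
    (indicator_le_self _ _ _).trans (min_le_left _ _)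
  have hmono : Monotone T := fun N M hNM x => by
    refine (indicator_le_indicator_of_subset (monotone_spanningSets μ hNM)
      (fun _ => zero_le) x).trans (indicator_le_indicator ?_)
    gcongr
  have hsup : ∀ x, A x = ⨆ N, T N x := fun x => by
    apply le_antisymm _ (iSup_le fun N => hTA N x)
    refine le_of_forall_lt fun c hc => ?_
    obtain ⟨n, hn⟩ := ENNReal.exists_nat_gt hc.ne_top
    set N := max n (spanningSetsIndex μ x)
    refine lt_of_lt_of_le ?_ (le_iSup (fun N => T N x) N)
    simp only [hT]
    rw [indicator_of_mem (monotone_spanningSets μ (le_max_right _ _)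
      (mem_spanningSetsIndex μ x))]
    exact lt_min hc (hn.trans_le (by exact_mod_cast le_max_left _ _))
  have hI : ∀ N, ∫⁻ x, T N x ^ p' ∂μ ≠ ∞ := fun N => by
    refine ne_top_of_le_ne_top (b := ∫⁻ x in spanningSets μ N, (N : ℝ≥0∞) ^ p' ∂μ) ?_ ?_
    · rw [setLIntegral_const]
      exact ENNReal.mul_ne_top (ENNReal.rpow_ne_top_of_nonneg h0'.le (ENNReal.natCast_ne_top N))
        (measure_spanningSets_lt_top μ N).ne
    · rw [← lintegral_indicator (measurableSet_spanningSets μ N)]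
      refine lintegral_mono fun x => ?_
      by_cases hx : x ∈ spanningSets μ N
      · simp only [hT, indicator_of_mem hx]
        gcongr
        exact min_le_right _ _
      · simp [hT, hx, h0']
  have hN : ∀ N, ∫⁻ x, T N x ^ p' ∂μ ≤ m ^ p' := fun N => by
    obtain ⟨k1, k2⟩ := extremal_holder μ hp (hTm N) (hI N)
    have := k2.trans ((lintegral_mono fun x => by gcongr; exact hTA N x).trans
      (h _ (((hTm N).pow_const _).mul_const _) k1))
    rwa [one_div, ENNReal.rpow_inv_le_iff h0'] at this
  rw [one_div, ENNReal.rpow_inv_le_iff h0']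
  calc ∫⁻ x, A x ^ p' ∂μ = ∫⁻ x, ⨆ N, T N x ^ p' ∂μ := by
        refine lintegral_congr fun x => ?_
        rw [hsup x, (ENNReal.monotone_rpow_of_nonneg h0'.le).map_iSup_of_continuousAt
          ENNReal.continuous_rpow_const.continuousAt (by simp [h0'])]
    _ = ⨆ N, ∫⁻ x, T N x ^ p' ∂μ := lintegral_iSup (fun N => (hTm N).pow_const _)
        fun N M hNM x => ENNReal.rpow_le_rpow (hmono hNM x) h0'.le
    _ ≤ m ^ p' := iSup_le hN

lemma one_le_conjExp {q : ℝ≥0∞} (hq : 1 ≤ q) : 1 ≤ conjExp q := by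
  rcases hq.eq_or_lt with rfl | hq1
  · simp [conjExp_one]
  by_cases hq' : q = ∞
  · simp [hq', conjExp_top]
  · obtain ⟨h1, h2⟩ := holderConjugate_conjExp hq1 hq'
    rw [← ENNReal.ofReal_toReal h1, ← ENNReal.ofReal_one]
    exact ENNReal.ofReal_le_ofReal h2.symm.lt.le

lemma mixedNorm_univ {α : Type*} [MeasurableSpace α] (μ : Measure α) (p : ℝ) (q : ℝ≥0∞)
    (g : ℤ → α → ℝ≥0∞) :
    mixedNorm μ univ p q g = (∫⁻ x, lqNorm q (fun k => g k x) ^ p ∂μ) ^ (1 / p) := by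
  rw [mixedNorm, Measure.restrict_univ]

/-- The converse of Hölder's inequality in `L^p(l^q)`. -/
lemma mixedNorm_conj_le_of_forall {α : Type*} [MeasurableSpace α] (μ : Measure α)
    [SigmaFinite μ] {p p' : ℝ} (hp : p.HolderConjugate p') {q : ℝ≥0∞} (hq : 1 ≤ q)
    {G : ℤ → α → ℝ≥0∞}
    (hG : ∀ k, Measurable (G k)) (hfin : ∀ k x, G k x ≠ ∞) {m : ℝ≥0∞}
    (h : ∀ f : ℤ → α → ℝ≥0∞, (∀ k, Measurable (f k)) → mixedNorm μ univ p q f ≤ 1 →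
      ∫⁻ x, ∑' k, f k x * G k x ∂μ ≤ m) :
    mixedNorm μ univ p' (conjExp q) G ≤ m := by
  rw [mixedNorm_univ]
  refine lintegral_rpow_le_of_forall μ hp (measurable_lqNorm _ hG) fun φ hφ hφ1 => ?_
  have hGN : ∀ N : ℕ, ∀ k, Measurable fun x =>
      (Finset.Icc (-(N : ℤ)) N : Set ℤ).indicator (fun k => G k x) k := fun N k => by
    by_cases hk : k ∈ (Finset.Icc (-(N : ℤ)) N : Set ℤ)
    · simpa only [indicator_of_mem hk] using hG k
    · simp only [indicator_of_notMem hk, measurable_const]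
  rw [lintegral_congr fun x => by
    rw [lqNorm_eq_iSup_truncate (one_le_conjExp hq), ENNReal.mul_iSup]]
  have hm : ∀ N : ℕ, Measurable fun x => φ x * lqNorm (conjExp q)
      ((Finset.Icc (-(N : ℤ)) N : Set ℤ).indicator fun k => G k x) := fun N =>
    hφ.mul (measurable_lqNorm _ (hGN N))
  rw [lintegral_iSup hm]
  · refine iSup_le fun N => ?_
    obtain ⟨a, ha, ha1, haG⟩ :=
      exists_measurable_extremal hq hG hfin (Finset.Icc (-(N : ℤ)) N)
    refine le_trans (lintegral_mono fun x => ?_)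
      (h (fun k x => φ x * a k x) (fun k => hφ.mul (ha k)) ?_)
    · simp only [mul_assoc, ENNReal.tsum_mul_left]
      gcongr
      exact haG x
    · rw [mixedNorm_univ]
      refine ENNReal.rpow_le_one (le_trans (lintegral_mono fun x => ?_) hφ1)
        (one_div_nonneg.2 hp.nonneg)
      simp only [lqNorm_const_mul hq]
      exact ENNReal.rpow_le_rpow (mul_le_of_le_one_right' (ha1 x)) hp.nonneg
  · intro N M hNM x
    dsimp only
    gcongr
    refine lqNorm_mono _ fun k => indicator_le_indicator_of_subset ?_ (fun _ => zero_le) k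
    simp only [Finset.coe_Icc]
    exact Icc_subset_Icc (by simpa using hNM) (by simpa using hNM)

omit [BorelSpace X] in
/-- A measure that is finite on balls is `σ`-finite. -/
lemma sigmaFinite_of_measure_ball_ne_top {μ : Measure X} [Nonempty X]
    (hfin : ∀ (x : X) (r : ℝ), μ (ball x r) ≠ ∞) : SigmaFinite μ := by
  obtain ⟨x⟩ := ‹Nonempty X›
  exact ⟨⟨⟨fun n => ball x n, fun _ => trivial, fun n => (hfin x n).lt_top, iUnion_ball_nat x⟩⟩⟩

/-- A metric space carrying a measure that is positive and finite on balls is second countable. -/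
lemma secondCountableTopology_of_measure_ball {μ : Measure X} [SigmaFinite μ]
    (hpos : ∀ (x : X) (r : ℝ), 0 < r → 0 < μ (ball x r)) : SecondCountableTopology X := by
  refine Metric.secondCountable_of_almost_dense_set fun ε hε => ?_
  obtain ⟨N, hN⟩ := zorn_subset {N : Set X | N.Pairwise fun x y => ε ≤ dist x y}
    fun c hc hch => ⟨⋃₀ c, (pairwise_sUnion hch.directedOn).2 fun s hs => hc hs,
      fun s hs => subset_sUnion_of_mem hs⟩
  refine ⟨N, ?_, fun x => ?_⟩
  · have hd : Pairwise (Function.onFun Disjoint fun i : N => ball (i : X) (ε / 2)) := by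
      intro i j hij
      refine ball_disjoint_ball ?_
      have := hN.prop i.2 j.2 (fun h => hij (Subtype.ext h))
      linarith
    have := Measure.countable_meas_pos_of_disjoint_iUnion (μ := μ)
      (fun _ => measurableSet_ball) hd
    have huniv : {i : N | 0 < μ (ball (i : X) (ε / 2))} = univ :=
      eq_univ_of_forall fun i => hpos i (ε / 2) (half_pos hε)
    rw [huniv, countable_univ_iff] at this
    exact countable_coe_iff.1 this
  · by_contra! hx
    have hxN : x ∉ N := fun h => by
      have := hx x h
      rw [dist_self] at this
      exact absurd this hε.le.not_gt
    refine hxN (hN.le_of_ge (y := insert x N) ?_ (subset_insert x N) (mem_insert x N))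
    refine hN.prop.insert fun y hy _ => ⟨(hx y hy).le, ?_⟩
    rw [dist_comm]
    exact (hx y hy).le

omit [BorelSpace X] in
/-- The measure of a ball is lower semicontinuous in the centre. -/
lemma lowerSemicontinuous_measure_ball (ρ : Measure X) (r : ℝ) :
    LowerSemicontinuous fun x => ρ (ball x r) := by
  intro x c hc
  have hU : ball x r = ⋃ n : ℕ, ball x (r - 1 / (n + 1)) := by
    ext y
    simp only [mem_ball, mem_iUnion]
    refine ⟨fun h => ?_, fun ⟨n, h⟩ => h.trans (sub_lt_self _ Nat.one_div_pos_of_nat)⟩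
    obtain ⟨n, hn⟩ := exists_nat_one_div_lt (sub_pos.2 h)
    exact ⟨n, by linarith⟩
  have hmono : Monotone fun n : ℕ => ball x (r - 1 / ((n : ℝ) + 1)) := fun n m h =>
    ball_subset_ball (sub_le_sub_left (Nat.one_div_le_one_div h) r)
  dsimp only at hc
  rw [hU, hmono.measure_iUnion] at hc
  obtain ⟨n, hn⟩ := lt_iSup_iff.1 hc
  filter_upwards [ball_mem_nhds x (Nat.one_div_pos_of_nat (α := ℝ) (n := n))] with y hy
  refine hn.trans_le (measure_mono (ball_subset_ball' ?_))
  rw [mem_ball, dist_comm] at hy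
  linarith

lemma measurable_measure_ball (ρ : Measure X) (r : ℝ) : Measurable fun x => ρ (ball x r) :=
  (lowerSemicontinuous_measure_ball ρ r).measurable

lemma measurable_div_measure_ball {g : X → ℝ≥0∞} (hg : Measurable g) (μ : Measure X) (r : ℝ) :
    Measurable fun y => g y / μ (ball y r) :=
  hg.div (measurable_measure_ball μ r)

/-- `H_β f` expressed through the measures with densities `f_n / μ(B(·, 2^{-n}))`. -/
lemma Hpot_eq_tsum_withDensity (μ : Measure X) (β : ℝ) (f : ℤ → X → ℝ≥0∞) (x : X) :
    Hpot μ β f x = ∑' n : ℤ, open Classical in if validIdx X n then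
      (2 : ℝ≥0∞) ^ (-β * (n : ℝ)) *
        μ.withDensity (fun y => f n y / μ (ball y ((2 : ℝ) ^ (-n)))) (ball x ((2 : ℝ) ^ (-n)))
      else 0 := by
  unfold Hpot
  refine tsum_congr fun n => ?_
  split_ifs with hn
  · rw [withDensity_apply _ measurableSet_ball, ← lintegral_indicator measurableSet_ball]
    congr 1
    refine lintegral_congr fun y => ?_
    by_cases h : x ∈ ball y ((2 : ℝ) ^ (-n))
    · rw [indicator_of_mem h, indicator_of_mem (mem_ball_comm.1 h), one_mul]
    · rw [indicator_of_notMem h, indicator_of_notMem (fun h' => h (mem_ball_comm.1 h')), zero_mul,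
        ENNReal.zero_div]
  · rfl

lemma lowerSemicontinuous_Hpot (μ : Measure X) (β : ℝ) (f : ℤ → X → ℝ≥0∞) :
    LowerSemicontinuous (Hpot μ β f) := by
  rw [funext (Hpot_eq_tsum_withDensity μ β f)]
  refine lowerSemicontinuous_tsum fun n => ?_
  split_ifs with hn
  · simp only [← smul_eq_mul, ← Measure.smul_apply]
    exact lowerSemicontinuous_measure_ball _ _
  · exact lowerSemicontinuous_const

lemma Hpot_const_mul {μ : Measure X} {β : ℝ} {c : ℝ≥0∞} {f : ℤ → X → ℝ≥0∞}
    (hf : ∀ n, Measurable (f n)) (x : X) :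
    Hpot μ β (fun n y => c * f n y) x = c * Hpot μ β f x := by
  rw [Hpot_eq_tsum_withDensity, Hpot_eq_tsum_withDensity, ← ENNReal.tsum_mul_left]
  refine tsum_congr fun n => ?_
  split_ifs with hn
  · have h : (fun y => c * f n y / μ (ball y ((2 : ℝ) ^ (-n)))) =
        c • fun y => f n y / μ (ball y ((2 : ℝ) ^ (-n))) := by
      ext y
      simp [mul_div_assoc]
    rw [h, withDensity_smul _ (measurable_div_measure_ball (hf n) μ _), Measure.smul_apply,
      smul_eq_mul, mul_left_comm]
  · rw [mul_zero]

lemma Hpot_add {μ : Measure X} {β : ℝ} {f g : ℤ → X → ℝ≥0∞}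
    (hf : ∀ n, Measurable (f n)) (x : X) :
    Hpot μ β (fun n y => f n y + g n y) x = Hpot μ β f x + Hpot μ β g x := by
  simp only [Hpot_eq_tsum_withDensity]
  rw [← ENNReal.tsum_add]
  refine tsum_congr fun n => ?_
  split_ifs with hn
  · have h : (fun y => (f n y + g n y) / μ (ball y ((2 : ℝ) ^ (-n)))) =
        (fun y => f n y / μ (ball y ((2 : ℝ) ^ (-n)))) +
          fun y => g n y / μ (ball y ((2 : ℝ) ^ (-n))) := by
      ext y
      simp [ENNReal.add_div]
    rw [h, withDensity_add_left (measurable_div_measure_ball (hf n) μ _), Measure.add_apply,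
      mul_add]
  · rw [add_zero]

lemma measurable_Hcheck (μ ν : Measure X) (β : ℝ) (n : ℤ) : Measurable (Hcheck μ ν β n) := by
  unfold Hcheck
  split_ifs
  · exact ((measurable_measure_ball ν _).const_mul _).div (measurable_measure_ball μ _)
  · exact measurable_const

omit [BorelSpace X] in
lemma Hcheck_ne_top {μ ν : Measure X} [IsFiniteMeasure ν] {β : ℝ}
    (hpos : ∀ (x : X) (r : ℝ), 0 < r → 0 < μ (ball x r)) (n : ℤ) (x : X) :
    Hcheck μ ν β n x ≠ ∞ := by
  unfold Hcheck
  split_ifs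
  · exact ENNReal.div_ne_top (ENNReal.mul_ne_top
      (ENNReal.rpow_ne_top_of_ne_zero (by simp) (by simp)) (measure_ne_top ν _))
      (hpos x _ (by positivity)).ne'
  · exact ENNReal.zero_ne_top

/-- Tonelli's theorem for `ρ(B(x, r))` when `ρ` has a density. -/
lemma lintegral_withDensity_ball [SecondCountableTopology X] (μ ν : Measure X) [SFinite μ]
    [SFinite ν] {w : X → ℝ≥0∞} (hw : Measurable w) (r : ℝ) :
    ∫⁻ x, μ.withDensity w (ball x r) ∂ν = ∫⁻ y, w y * ν (ball y r) ∂μ := by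
  have hs : MeasurableSet {z : X × X | dist z.1 z.2 < r} :=
    (isOpen_lt continuous_dist continuous_const).measurableSet
  have hF : Measurable ({z : X × X | dist z.1 z.2 < r}.indicator fun z => w z.2) :=
    (hw.comp measurable_snd).indicator hs
  calc ∫⁻ x, μ.withDensity w (ball x r) ∂ν
      = ∫⁻ x, ∫⁻ y, {z : X × X | dist z.1 z.2 < r}.indicator (fun z => w z.2) (x, y) ∂μ ∂ν := by
        refine lintegral_congr fun x => ?_
        rw [withDensity_apply _ measurableSet_ball, ← lintegral_indicator measurableSet_ball]
        refine lintegral_congr fun y => ?_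
        simp only [indicator, mem_ball, mem_ofPred_eq, dist_comm y x]
    _ = ∫⁻ y, ∫⁻ x, {z : X × X | dist z.1 z.2 < r}.indicator (fun z => w z.2) (x, y) ∂ν ∂μ :=
        lintegral_lintegral_swap hF.aemeasurable
    _ = ∫⁻ y, w y * ν (ball y r) ∂μ := by
        refine lintegral_congr fun y => ?_
        rw [← lintegral_indicator_const measurableSet_ball]
        refine lintegral_congr fun x => ?_
        simp only [indicator, mem_ball, mem_ofPred_eq]

/-- The duality between `H_β` and `Ȟ_β`. -/
lemma lintegral_Hpot [SecondCountableTopology X] (μ ν : Measure X) [SFinite μ]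
    [SFinite ν] (β : ℝ) {f : ℤ → X → ℝ≥0∞} (hf : ∀ n, Measurable (f n)) :
    ∫⁻ x, Hpot μ β f x ∂ν = ∫⁻ y, ∑' n, f n y * Hcheck μ ν β n y ∂μ := by
  simp only [Hpot_eq_tsum_withDensity]
  rw [lintegral_tsum, lintegral_tsum]
  · refine tsum_congr fun n => ?_
    by_cases hn : validIdx X n
    · simp only [Hcheck, hn, if_true]
      rw [lintegral_const_mul _ (measurable_measure_ball _ _),
        lintegral_withDensity_ball μ ν (measurable_div_measure_ball (hf n) μ _),
        ← lintegral_const_mul' _ _ (ENNReal.rpow_ne_top_of_ne_zero (by simp) (by simp))]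
      refine lintegral_congr fun y => ?_
      simp only [div_eq_mul_inv]
      ring
    · simp [Hcheck, hn]
  · exact fun n => ((hf n).mul (measurable_Hcheck μ ν β n)).aemeasurable
  · intro n
    split_ifs
    · exact ((measurable_measure_ball _ _).const_mul _).aemeasurable
    · exact aemeasurable_const

/-- A lower semicontinuous `[0, ∞]`-valued function is the supremum of an increasing sequence of
bounded continuous functions. -/
lemma exists_monotone_continuous_iSup_eq {α : Type*} [PseudoEMetricSpace α] {g : α → ℝ≥0∞}
    (hg : LowerSemicontinuous g) :
    ∃ h : ℕ → α → ℝ≥0∞, Monotone h ∧ (∀ n, Continuous (h n)) ∧ (∀ n x, h n x ≤ n) ∧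
      ∀ x, ⨆ n, h n x = g x := by
  refine ⟨fun n x => ⨅ y, min (g y) n + n * edist x y, fun n m hnm x => ?_, fun n => ?_,
    fun n x => ?_, fun x => ?_⟩
  · dsimp only
    gcongr
  · refine continuous_of_le_add_edist n (ENNReal.natCast_ne_top n) fun x z => ?_
    rw [ENNReal.iInf_add]
    refine iInf_mono fun y => ?_
    rw [add_assoc, ← mul_add]
    gcongr
    rw [add_comm]
    exact edist_triangle _ _ _
  · refine iInf_le_of_le x ?_
    simp
  · refine le_antisymm (iSup_le fun n => iInf_le_of_le x ?_) (le_of_forall_lt fun c hc => ?_)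
    · simp
    · obtain ⟨b, hcb, hb⟩ := exists_between hc
      obtain ⟨ε, hε, hball⟩ := EMetric.mem_nhds_iff.1 (hg x b hb)
      obtain ⟨n, hn⟩ := ENNReal.exists_nat_gt (ENNReal.div_ne_top hb.ne_top hε.ne')
      obtain ⟨k, hk⟩ := ENNReal.exists_nat_gt hb.ne_top
      refine hcb.trans_le (le_iSup_of_le (max n k) (le_iInf fun y => ?_))
      by_cases hy : edist y x < ε
      · refine le_add_right (le_min (le_of_lt (hball hy)) (hk.le.trans ?_))
        exact_mod_cast le_max_right n k
      · refine le_add_left ?_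
        rw [not_lt, edist_comm] at hy
        have h1 : b ≤ n * ε :=
          (ENNReal.div_le_iff_le_mul (Or.inl hε.ne')
            (Or.inr (zero_le.trans_lt hn).ne')).1 hn.le
        refine h1.trans ?_
        gcongr
        exact le_max_left n k

lemma mixedNorm_const_mul {α : Type*} [MeasurableSpace α] {μ : Measure α} {p : ℝ} (hp : 1 ≤ p)
    {q : ℝ≥0∞} (hq : 1 ≤ q) {c : ℝ≥0∞} (hc : c ≠ ∞) (f : ℤ → α → ℝ≥0∞) :
    mixedNorm μ univ p q (fun n x => c * f n x) = c * mixedNorm μ univ p q f := by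
  have h0 : 0 < p := by linarith
  simp only [mixedNorm_univ, lqNorm_const_mul hq, ENNReal.mul_rpow_of_nonneg _ _ h0.le]
  rw [lintegral_const_mul' _ _ (ENNReal.rpow_ne_top_of_nonneg h0.le hc),
    ENNReal.mul_rpow_of_nonneg _ _ (by positivity), ← ENNReal.rpow_mul, mul_one_div_cancel h0.ne',
    ENNReal.rpow_one]

lemma mixedNorm_mono {α : Type*} [MeasurableSpace α] {μ : Measure α} {p : ℝ} (hp : 0 ≤ p)
    (q : ℝ≥0∞) {f g : ℤ → α → ℝ≥0∞} (h : ∀ n x, f n x ≤ g n x) :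
    mixedNorm μ univ p q f ≤ mixedNorm μ univ p q g := by
  simp only [mixedNorm_univ]
  gcongr with x
  exact lqNorm_mono q fun k => h k x

lemma mixedNorm_add_le {α : Type*} [MeasurableSpace α] {μ : Measure α} {p : ℝ} (hp : 1 ≤ p)
    {q : ℝ≥0∞} (hq : 1 ≤ q) {f g : ℤ → α → ℝ≥0∞} (hf : ∀ n, Measurable (f n))
    (hg : ∀ n, Measurable (g n)) :
    mixedNorm μ univ p q (fun n x => f n x + g n x) ≤
      mixedNorm μ univ p q f + mixedNorm μ univ p q g := by
  simp only [mixedNorm_univ]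
  refine le_trans ?_ (ENNReal.lintegral_Lp_add_le (measurable_lqNorm q hf).aemeasurable
    (measurable_lqNorm q hg).aemeasurable hp)
  gcongr with x
  exact lqNorm_add_le hq _ _

/-- The **Riesz–Markov–Kakutani theorem** for a compact space. -/
lemma exists_isFiniteMeasure_integral_eq {Y : Type*} [TopologicalSpace Y] [T2Space Y]
    [CompactSpace Y] [MeasurableSpace Y] [BorelSpace Y] (Λ : C(Y, ℝ) →ₗ[ℝ] ℝ)
    (hΛ : ∀ h, 0 ≤ h → 0 ≤ Λ h) :
    ∃ ν : Measure Y, IsFiniteMeasure ν ∧ ∀ h : C(Y, ℝ), ∫ x, h x ∂ν = Λ h := by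
  let Φ : CompactlySupportedContinuousMap Y ℝ →ₗ[ℝ] ℝ :=
    { toFun := fun g => Λ g.toContinuousMap
      map_add' := fun g g' => Λ.map_add g.toContinuousMap g'.toContinuousMap
      map_smul' := fun c g => Λ.map_smul c g.toContinuousMap }
  let Ψ := PositiveLinearMap.mk₀ Φ fun g hg =>
    hΛ _ fun x => CompactlySupportedContinuousMap.le_def.1 hg x
  exact ⟨RealRMK.rieszMeasure Ψ, inferInstance, fun h => RealRMK.integral_rieszMeasure Ψ
    (CompactlySupportedContinuousMap.continuousMapEquiv h)⟩

/-- A minimax principle: if every function in a convex set of continuous functions on a compact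
space takes a value `≤ m`, then some nonzero measure integrates all of them to at most `m` times
its mass. -/
lemma exists_measure_integral_le {Y : Type*} [TopologicalSpace Y] [T2Space Y]
    [CompactSpace Y] [MeasurableSpace Y] [BorelSpace Y] {K : Set C(Y, ℝ)} (hK : Convex ℝ K)
    (hK0 : 0 ∈ K) {m : ℝ} (hm : ∀ h ∈ K, ∃ x, h x ≤ m) :
    ∃ ν : Measure Y, IsFiniteMeasure ν ∧ ν univ ≠ 0 ∧
      ∀ h ∈ K, ∫ x, h x ∂ν ≤ m * ν.real univ := by
  have hconv : Convex ℝ {h : C(Y, ℝ) | MapsTo h univ (Ioi m)} := by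
    intro h hh g hg a b ha hb hab x _
    exact convex_Ioi m (hh (mem_univ x)) (hg (mem_univ x)) ha hb hab
  have hdisj : Disjoint {h : C(Y, ℝ) | MapsTo h univ (Ioi m)} K := by
    rw [Set.disjoint_left]
    intro h hh hhK
    obtain ⟨x, hx⟩ := hm h hhK
    exact absurd (hh (mem_univ x)) hx.not_gt
  obtain ⟨L, u, hLU, hLK⟩ := geometric_hahn_banach_open hconv
    (ContinuousMap.isOpen_setOfPred_mapsTo isCompact_univ isOpen_Ioi) hK hdisj
  have hu : u ≤ 0 := by simpa using hLK 0 hK0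
  have hconst : ∀ r : ℝ, L (ContinuousMap.const Y r) = r * L 1 := fun r => by
    rw [← smul_eq_mul, ← map_smul]
    congr 1
    ext x
    simp
  have hpos : ∀ h : C(Y, ℝ), 0 ≤ h → 0 ≤ -L h := fun h hh => by
    by_contra! hneg
    have hneg' : 0 < L h := by linarith
    set t : ℝ := |u - (m + 1) * L 1| / L h
    have ht : 0 ≤ t := by positivity
    have := hLU (ContinuousMap.const Y (m + 1) + t • h) fun x _ => by
      have : 0 ≤ t * h x := mul_nonneg ht (hh x)
      simp only [ContinuousMap.add_apply, ContinuousMap.const_apply, ContinuousMap.smul_apply,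
        smul_eq_mul, mem_Ioi]
      linarith
    rw [map_add, map_smul, hconst, smul_eq_mul, div_mul_cancel₀ _ hneg'.ne'] at this
    linarith [le_abs_self (u - (m + 1) * L 1)]
  obtain ⟨ν, hν, hint⟩ := exists_isFiniteMeasure_integral_eq (-L.toLinearMap) hpos
  have hint' : ∀ h : C(Y, ℝ), ∫ x, h x ∂ν = -L h := hint
  have hmass : ν.real univ = -L 1 := by
    rw [← hint' 1]
    simp
  refine ⟨ν, hν, fun h0 => ?_, fun h hh => ?_⟩
  · have h1 : L 1 = 0 := by
      rw [Measure.real, h0, ENNReal.toReal_zero] at hmass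
      linarith
    have := hLU (ContinuousMap.const Y (m + 1)) fun x _ => by simp
    rw [hconst, h1] at this
    linarith
  · rw [hint', hmass]
    have h1 : -u ≤ m * -L 1 := by
      refine le_of_forall_pos_le_add fun ε hε => ?_
      have hδ : 0 < ε / (|L 1| + 1) := by positivity
      have := hLU (ContinuousMap.const Y (m + ε / (|L 1| + 1))) fun x _ => by simpa using hδ
      rw [hconst] at this
      have h2 : ε / (|L 1| + 1) * -L 1 ≤ ε := by
        rw [div_mul_eq_mul_div, div_le_iff₀ (by positivity)]
        have := neg_le_abs (L 1)
        nlinarith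
      linarith
    linarith [hLK h hh]

/-- A finite Borel measure carried by a compact set is a Radon measure on it. -/
lemma isRadonOn_of_isFiniteMeasure {ν : Measure X} [IsFiniteMeasure ν] {E : Set X}
    (hE : IsCompact E) (hν : ν Eᶜ = 0) : IsRadonOn ν E := by
  refine ⟨hν, measure_ne_top ν E, fun F hF hFE => ?_, fun F hF hFE => ?_⟩
  · have hUE : ∀ U, ν (U ∩ E) = ν U := fun U => by
      rw [inter_comm]
      exact Measure.measure_inter_eq_of_ae hν
    simp only [hUE]
    rw [F.measure_eq_iInf_isOpen ν]
    refine iInf_congr fun U => ?_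
    rw [iInf_comm]
    simp only [subset_inter_iff, hFE, and_true]
  · apply le_antisymm
    · refine le_of_forall_lt fun c hc => ?_
      obtain ⟨K, hKF, hK, hcK⟩ :=
        MeasurableSet.exists_lt_isClosed_of_ne_top hF (measure_ne_top ν F) hc
      exact hcK.trans_le (le_iSup_of_le K (le_iSup₂_of_le
        (hE.of_isClosed_subset hK (hKF.trans hFE)) hKF le_rfl))
    · exact iSup_le fun K => iSup₂_le fun _ hK => measure_mono hK

omit [BorelSpace X] in
lemma IsRadonOn.isFiniteMeasure {ν : Measure X} {E : Set X} (h : IsRadonOn ν E) :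
    IsFiniteMeasure ν := by
  refine ⟨?_⟩
  rw [← union_compl_self E]
  exact (measure_union_le _ _).trans_lt (by simpa [h.1] using h.2.1.lt_top)

lemma mixedNorm_zero {α : Type*} [MeasurableSpace α] (μ : Measure α) {p : ℝ} (hp : 1 ≤ p)
    {q : ℝ≥0∞} (hq : 1 ≤ q) : mixedNorm μ univ p q (fun _ _ => 0) = 0 := by
  simpa using mixedNorm_const_mul (μ := μ) hp hq ENNReal.zero_ne_top fun _ _ => 0

lemma measure_le_mixedNorm_mul_mixedNorm [SecondCountableTopology X] {μ ν : Measure X}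
    [SFinite μ] [SFinite ν] {p p' β : ℝ} (hp : p.HolderConjugate p') {q : ℝ≥0∞} (hq : 1 ≤ q)
    {E : Set X} (hE : MeasurableSet E) {f : ℤ → X → ℝ≥0∞} (hf : ∀ n, Measurable (f n))
    (hfE : ∀ x ∈ E, 1 ≤ Hpot μ β f x) :
    ν E ≤ mixedNorm μ univ p q f * mixedNorm μ univ p' (conjExp q) (Hcheck μ ν β) :=
  calc ν E = ∫⁻ _ in E, 1 ∂ν := by simp
    _ ≤ ∫⁻ x in E, Hpot μ β f x ∂ν := setLIntegral_mono' hE hfE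
    _ ≤ ∫⁻ x, Hpot μ β f x ∂ν := setLIntegral_le_lintegral _ _
    _ = ∫⁻ y, ∑' n, f n y * Hcheck μ ν β n y ∂μ := lintegral_Hpot μ ν β hf
    _ ≤ ∫⁻ y, lqNorm q (fun n => f n y) * lqNorm (conjExp q) (fun n => Hcheck μ ν β n y) ∂μ :=
      lintegral_mono fun y => tsum_mul_le_lqNorm_mul_lqNorm hq _ _
    _ ≤ mixedNorm μ univ p q f * mixedNorm μ univ p' (conjExp q) (Hcheck μ ν β) := by
      simp only [mixedNorm_univ]
      exact ENNReal.lintegral_mul_le_Lp_mul_Lq μ hp (measurable_lqNorm q hf).aemeasurable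
        (measurable_lqNorm _ (measurable_Hcheck μ ν β)).aemeasurable

omit [BorelSpace X] in
lemma le_CpCap_rpow {μ : Measure X} {p β : ℝ} (hp : 0 < p) {q : ℝ≥0∞} {E : Set X} {t : ℝ≥0∞}
    (h : ∀ f : ℤ → X → ℝ≥0∞, IsAdmissibleSeq f → (∀ x ∈ E, 1 ≤ Hpot μ β f x) →
      t ≤ mixedNorm μ univ p q f) :
    t ≤ CpCap μ β p q E ^ (1 / p) := by
  rw [one_div, ENNReal.le_rpow_inv_iff hp]
  exact le_iInf fun f => ENNReal.rpow_le_rpow (h f.1 f.2.1 f.2.2) hp.le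

omit [BorelSpace X] in
lemma CpCap_rpow_le {μ : Measure X} {p β : ℝ} (hp : 0 < p) {q : ℝ≥0∞} {E : Set X}
    {f : ℤ → X → ℝ≥0∞} (hf : IsAdmissibleSeq f) (hfE : ∀ x ∈ E, 1 ≤ Hpot μ β f x) :
    CpCap μ β p q E ^ (1 / p) ≤ mixedNorm μ univ p q f := by
  rw [one_div, ENNReal.rpow_inv_le_iff hp]
  exact iInf_le_of_le ⟨f, hf, hfE⟩ le_rfl

omit [BorelSpace X] in
lemma IsAdmissibleSeq.const_mul {f : ℤ → X → ℝ≥0∞} (hf : IsAdmissibleSeq f) (c : ℝ≥0∞) :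
    IsAdmissibleSeq fun n x => c * f n x :=
  ⟨fun n => (hf.1 n).const_mul c, fun n hn => by ext; simp [hf.2 n hn]⟩

omit [BorelSpace X] in
lemma IsAdmissibleSeq.add {f g : ℤ → X → ℝ≥0∞} (hf : IsAdmissibleSeq f)
    (hg : IsAdmissibleSeq g) : IsAdmissibleSeq fun n x => f n x + g n x :=
  ⟨fun n => (hf.1 n).add (hg.1 n), fun n hn => by ext; simp [hf.2 n hn, hg.2 n hn]⟩

/-- The continuous minorants on `E` of the potentials of the unit ball of `L^p(X; l^q)`. -/
def potentialMinorants (μ : Measure X) (β p : ℝ) (q : ℝ≥0∞) (E : Set X) : Set C(E, ℝ) :=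
  {h | ∃ f, IsAdmissibleSeq f ∧ mixedNorm μ univ p q f ≤ 1 ∧
    ∀ x : E, ENNReal.ofReal (h x) ≤ Hpot μ β f x}

omit [BorelSpace X] in
lemma zero_mem_potentialMinorants (μ : Measure X) (β : ℝ) {p : ℝ} (hp : 1 ≤ p) {q : ℝ≥0∞}
    (hq : 1 ≤ q) (E : Set X) : 0 ∈ potentialMinorants μ β p q E :=
  ⟨fun _ _ => 0, ⟨fun _ => measurable_const, fun _ _ => rfl⟩,
    by simp [mixedNorm_zero μ hp hq], fun x => by simp⟩

lemma convex_potentialMinorants (μ : Measure X) (β : ℝ) {p : ℝ} (hp : 1 ≤ p) {q : ℝ≥0∞}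
    (hq : 1 ≤ q) (E : Set X) : Convex ℝ (potentialMinorants μ β p q E) := by
  rintro h₁ ⟨f₁, hf₁, hn₁, hh₁⟩ h₂ ⟨f₂, hf₂, hn₂, hh₂⟩ a b ha hb hab
  refine ⟨fun n x => ENNReal.ofReal a * f₁ n x + ENNReal.ofReal b * f₂ n x,
    (hf₁.const_mul _).add (hf₂.const_mul _), ?_, fun x => ?_⟩
  · calc
      _ ≤ ENNReal.ofReal a * mixedNorm μ univ p q f₁ +
          ENNReal.ofReal b * mixedNorm μ univ p q f₂ := by
        rw [← mixedNorm_const_mul hp hq ENNReal.ofReal_ne_top,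
          ← mixedNorm_const_mul hp hq ENNReal.ofReal_ne_top]
        exact mixedNorm_add_le hp hq (hf₁.const_mul _).1 (hf₂.const_mul _).1
      _ ≤ ENNReal.ofReal a * 1 + ENNReal.ofReal b * 1 := by gcongr
      _ = 1 := by rw [mul_one, mul_one, ← ENNReal.ofReal_add ha hb, hab, ENNReal.ofReal_one]
  · rw [Hpot_add (hf₁.const_mul _).1, Hpot_const_mul hf₁.1, Hpot_const_mul hf₂.1]
    calc ENNReal.ofReal ((a • h₁ + b • h₂) x) ≤
          ENNReal.ofReal (a * h₁ x) + ENNReal.ofReal (b * h₂ x) := ENNReal.ofReal_add_le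
      _ = ENNReal.ofReal a * ENNReal.ofReal (h₁ x) +
          ENNReal.ofReal b * ENNReal.ofReal (h₂ x) := by
        rw [ENNReal.ofReal_mul ha, ENNReal.ofReal_mul hb]
      _ ≤ _ := by gcongr <;> [exact hh₁ x; exact hh₂ x]

lemma exists_le_inv_of_mem_potentialMinorants {μ : Measure X} {β p : ℝ} (hp : 1 ≤ p)
    {q : ℝ≥0∞} (hq : 1 ≤ q) {E : Set X} {c : ℝ≥0} (hc0 : 0 < c)
    (hc : c < CpCap μ β p q E ^ (1 / p)) {h : C(E, ℝ)}
    (hh : h ∈ potentialMinorants μ β p q E) : ∃ x, h x ≤ (c : ℝ)⁻¹ := by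
  obtain ⟨f, hf, hn, hfh⟩ := hh
  by_contra! hlt
  refine hc.not_ge ((CpCap_rpow_le (by linarith) (hf.const_mul c) fun x hx => ?_).trans ?_)
  · rw [Hpot_const_mul hf.1]
    have h1 : (c : ℝ≥0∞)⁻¹ ≤ Hpot μ β f x := by
      refine le_trans ?_ (hfh ⟨x, hx⟩)
      rw [← ENNReal.coe_inv hc0.ne', ← ENNReal.ofReal_coe_nnreal, NNReal.coe_inv]
      exact ENNReal.ofReal_le_ofReal (hlt _).le
    calc (1 : ℝ≥0∞) = c * (c : ℝ≥0∞)⁻¹ :=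
          (ENNReal.mul_inv_cancel (by exact_mod_cast hc0.ne') ENNReal.coe_ne_top).symm
      _ ≤ c * Hpot μ β f x := by gcongr
  · rw [mixedNorm_const_mul hp hq ENNReal.coe_ne_top]
    exact mul_le_of_le_one_right' hn

lemma lintegral_Hpot_le_of_forall_minorant {μ : Measure X} {β p : ℝ} {q : ℝ≥0∞} {E : Set X}
    {ν : Measure E} [IsFiniteMeasure ν] {m : ℝ}
    (hν : ∀ h ∈ potentialMinorants μ β p q E, ∫ x, h x ∂ν ≤ m)
    {f : ℤ → X → ℝ≥0∞} (hf : IsAdmissibleSeq f) (hn : mixedNorm μ univ p q f ≤ 1) :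
    ∫⁻ x, Hpot μ β f x ∂ν ≤ ENNReal.ofReal m := by
  obtain ⟨g, hmono, hcont, hle, hsup⟩ := exists_monotone_continuous_iSup_eq
    (LowerSemicontinuous.comp (lowerSemicontinuous_Hpot μ β f)
      (continuous_subtype_val (p := (· ∈ E))))
  have hne : ∀ n x, g n x ≠ ∞ := fun n x =>
    ne_top_of_le_ne_top (ENNReal.natCast_ne_top n) (hle n x)
  have hsup' : ∀ x : E, Hpot μ β f x = ⨆ n, g n x := fun x => (hsup x).symm
  simp only [hsup']
  rw [lintegral_iSup (fun n => (hcont n).measurable) hmono]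
  refine iSup_le fun n => ?_
  let h : C(E, ℝ) := ⟨fun x => (g n x).toReal, ENNReal.continuousOn_toReal.comp_continuous
    (hcont n) (hne n)⟩
  have hgh : ∀ x, ENNReal.ofReal (h x) = g n x := fun x => ENNReal.ofReal_toReal (hne n x)
  have hh : h ∈ potentialMinorants μ β p q E :=
    ⟨f, hf, hn, fun x => by rw [hgh, hsup']; exact le_iSup (fun n => g n x) n⟩
  have hint : Integrable h ν := by
    refine Integrable.of_bound h.continuous.aestronglyMeasurable n (ae_of_all _ fun x => ?_)
    refine (Real.norm_of_nonneg ENNReal.toReal_nonneg).trans_le ?_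
    exact ENNReal.toReal_le_of_le_ofReal (by positivity) (by simpa using hle n x)
  simp only [← hgh]
  rw [← ofReal_integral_eq_lintegral_ofReal hint (ae_of_all _ fun x => ENNReal.toReal_nonneg)]
  exact ENNReal.ofReal_le_ofReal (hν h hh)

lemma mixedNorm_Hcheck_le_of_forall {μ ν : Measure X} [SigmaFinite μ] [IsFiniteMeasure ν]
    [SecondCountableTopology X] (hpos : ∀ (x : X) (r : ℝ), 0 < r → 0 < μ (ball x r))
    {p p' β : ℝ} (hp : p.HolderConjugate p') {q : ℝ≥0∞} (hq : 1 ≤ q) {m : ℝ≥0∞}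
    (h : ∀ f : ℤ → X → ℝ≥0∞, IsAdmissibleSeq f → mixedNorm μ univ p q f ≤ 1 →
      ∫⁻ x, Hpot μ β f x ∂ν ≤ m) :
    mixedNorm μ univ p' (conjExp q) (Hcheck μ ν β) ≤ m := by
  classical
  refine mixedNorm_conj_le_of_forall μ hp hq (measurable_Hcheck μ ν β) (Hcheck_ne_top hpos)
    fun f hf hn => ?_
  let f' : ℤ → X → ℝ≥0∞ := fun n => if validIdx X n then f n else 0
  have hf' : IsAdmissibleSeq f' := by
    refine ⟨fun n => ?_, fun n hn => if_neg hn⟩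
    by_cases hn : validIdx X n
    · simpa only [f', if_pos hn] using hf n
    · simpa only [f', if_neg hn] using measurable_zero
  have hle : ∀ n x, f' n x ≤ f n x := fun n x => by
    by_cases hn : validIdx X n <;> simp [f', hn]
  have heq : ∀ n x, f n x * Hcheck μ ν β n x = f' n x * Hcheck μ ν β n x := fun n x => by
    by_cases hn : validIdx X n <;> simp [f', Hcheck, hn]
  simp only [heq]
  rw [← lintegral_Hpot μ ν β hf'.1]
  exact h f' hf' ((mixedNorm_mono hp.nonneg q hle).trans hn)

lemma exists_isRadonOn_le_div [SecondCountableTopology X] {μ : Measure X} [SigmaFinite μ]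
    (hpos : ∀ (x : X) (r : ℝ), 0 < r → 0 < μ (ball x r)) {p p' β : ℝ}
    (hp : p.HolderConjugate p') {q : ℝ≥0∞} (hq : 1 ≤ q) {E : Set X} (hE : IsCompact E)
    {c : ℝ≥0} (hc0 : 0 < c) (hc : c < CpCap μ β p q E ^ (1 / p)) :
    ∃ ν : Measure X, IsRadonOn ν E ∧
      c ≤ ν E / mixedNorm μ univ p' (conjExp q) (Hcheck μ ν β) := by
  have : CompactSpace E := isCompact_iff_compactSpace.1 hE
  obtain ⟨ν, hν, hν0, hνK⟩ := exists_measure_integral_le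
    (convex_potentialMinorants μ β hp.lt.le hq E) (zero_mem_potentialMinorants μ β hp.lt.le hq E)
    fun h hh => exists_le_inv_of_mem_potentialMinorants hp.lt.le hq hc0 hc hh
  have hEmeas : MeasurableSet E := hE.measurableSet
  have hmass : ν.map Subtype.val E = ν univ := by
    rw [Measure.map_apply measurable_subtype_coe hEmeas]
    simp
  have hcompl : ν.map Subtype.val Eᶜ = 0 := by
    rw [Measure.map_apply measurable_subtype_coe hEmeas.compl]
    simp
  have hbound : mixedNorm μ univ p' (conjExp q) (Hcheck μ (ν.map Subtype.val) β) ≤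
      ENNReal.ofReal ((c : ℝ)⁻¹ * ν.real univ) := by
    refine mixedNorm_Hcheck_le_of_forall hpos hp hq fun f hf hn => ?_
    rw [lintegral_map (lowerSemicontinuous_Hpot μ β f).measurable measurable_subtype_coe]
    exact lintegral_Hpot_le_of_forall_minorant hνK hf hn
  refine ⟨ν.map Subtype.val, isRadonOn_of_isFiniteMeasure hE hcompl, ?_⟩
  rw [hmass, ENNReal.le_div_iff_mul_le (Or.inr hν0) (Or.inr (measure_ne_top ν univ))]
  calc _ ≤ c * ENNReal.ofReal ((c : ℝ)⁻¹ * ν.real univ) := by gcongr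
    _ = ν univ := by
      rw [← ENNReal.ofReal_coe_nnreal, ← ENNReal.ofReal_mul c.coe_nonneg,
        mul_inv_cancel_left₀ (by exact_mod_cast hc0.ne'), ofReal_measureReal]

theorem statement11
    (μ : Measure X) [Nontrivial X]
    (c_mu : ℝ≥0∞) (hc1 : 1 < c_mu) (hc2 : c_mu ≠ ∞) (hdbl : IsDoubling μ c_mu)
    (hpos : ∀ (x : X) (r : ℝ), 0 < r → 0 < μ (ball x r))
    (hfin : ∀ (x : X) (r : ℝ), μ (ball x r) ≠ ∞)
    (p β : ℝ) (q : ℝ≥0∞) (hp : 1 < p) (hq : 1 ≤ q) (hβ : 0 < β)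
    (E : Set X) (hE : IsCompact E) :
    CpCap μ β p q E ^ (1 / p) =
      ⨆ ν : {ν : Measure X // IsRadonOn ν E},
        ν.1 E / mixedNorm μ Set.univ (p / (p - 1)) (conjExp q) (Hcheck μ ν.1 β) := by
  have hpp : p.HolderConjugate (p / (p - 1)) := Real.HolderConjugate.conjExponent hp
  have : SigmaFinite μ := sigmaFinite_of_measure_ball_ne_top hfin
  have : SecondCountableTopology X := secondCountableTopology_of_measure_ball hpos
  refine le_antisymm ?_ (iSup_le fun ν => ?_)
  · refine ENNReal.le_of_forall_nnreal_lt fun c hc => ?_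
    rcases eq_or_ne c 0 with rfl | hc0
    · simp
    obtain ⟨ν, hν, hle⟩ := exists_isRadonOn_le_div hpos hpp hq hE (pos_iff_ne_zero.2 hc0) hc
    exact hle.trans (le_iSup_of_le ⟨ν, hν⟩ le_rfl)
  · have := ν.2.isFiniteMeasure
    exact le_CpCap_rpow hpp.pos fun f hf hfE => ENNReal.div_le_of_le_mul
      (measure_le_mixedNorm_mul_mixedNorm hpp hq hE.measurableSet hf.1 hfE)

end TLCap

end
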